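/- Fix n ≥ 1, positive lengths λ₁,…,λ_n, left ends x₁ < … < x_{n−1}, and a permutation π ∈ S_n. Let R_π be the r-configuration obtained by resolving conflicts in σ_{n−1}(x₁,…,x_{n−1}; λ_{π(1)},…,λ_{π(n−1)}), and let S_π be the number of right ends y_i of R_π lying in the segment [−λ_{π(n)}, 0]. Then, for Lebesgue-almost every such data: N_π(x₁,…,x_{n−1}; λ₁,…,λ_n) = S_π if the point −λ_{π(n)} belongs to the body of some cluster of R_π, and N_π(x₁,…,x_{n−1}; λ₁,…,λ_n) = S_π + 1 otherwise. -/

import Mathlib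

open MeasureTheory

/-- Extend a `Fin n`-tuple of reals to `ℕ` by zero (junk values beyond `n`). -/
noncomputable def natExt {n : ℕ} (f : Fin n → ℝ) : ℕ → ℝ :=
  fun k => if h : k < n then f ⟨k, h⟩ else 0

/-- The Lindley recursion: `z 0 = w 0`, `z (k+1) = max (z k + l k) (w (k+1))`. -/
noncomputable def lindleyNat (w l : ℕ → ℝ) : ℕ → ℝ
  | 0 => w 0
  | k + 1 => max (lindleyNat w l k + l k) (w (k + 1))

/-- Left ends of the r-configuration obtained by resolving conflicts of the sorted
configuration with left ends `w` and lengths `l`. -/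
noncomputable def resolve {n : ℕ} (w l : Fin n → ℝ) : Fin n → ℝ :=
  fun i => lindleyNat (natExt w) (natExt l) i

/-- `IsXHit p l m` : placing rods of lengths `l i` with left ends `p i` and resolving the
conflicts (after sorting the left ends), the resulting r-configuration has a hit of the
origin whose cluster is rooted at the rod originally placed at index `m`. -/
def IsXHit {n : ℕ} (p l : Fin n → ℝ) (m : Fin n) : Prop :=
  ∃ k r : Fin n, r ≤ k ∧
    resolve (p ∘ Tuple.sort p) (l ∘ Tuple.sort p) k + (l ∘ Tuple.sort p) k = 0 ∧
    resolve (p ∘ Tuple.sort p) (l ∘ Tuple.sort p) r = (p ∘ Tuple.sort p) r ∧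
    (∀ i : Fin n, r < i → i ≤ k →
      resolve (p ∘ Tuple.sort p) (l ∘ Tuple.sort p) i ≠ (p ∘ Tuple.sort p) i) ∧
    Tuple.sort p r = m

/-- Departure times of a single-server queue that becomes free at time `s`, customer `i`
arriving at time `w i` with service time `l i`. -/
noncomputable def departure (w l : ℕ → ℝ) (s : ℝ) : ℕ → ℝ
  | 0 => s
  | t + 1 => max (departure w l s t) (w t) + l t

theorem departure_max (w l : ℕ → ℝ) (a b : ℝ) (t : ℕ) :
    departure w l (max a b) t = max (departure w l a t) (b + ∑ u ∈ Finset.range t, l u) := by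
  induction t with
  | zero => simp [departure]
  | succ t ih =>
    rw [departure, departure, ih, Finset.sum_range_succ, ← add_assoc, max_add_add_right,
      max_right_comm]

theorem add_sum_le_departure (w l : ℕ → ℝ) (s : ℝ) (t : ℕ) :
    s + ∑ u ∈ Finset.range t, l u ≤ departure w l s t := by
  have h := departure_max w l s s t
  rw [max_self] at h
  rw [h]
  exact le_max_right _ _

theorem departure_succ_eq_shift (w l : ℕ → ℝ) (s : ℝ) (t : ℕ) :
    departure w l s (t + 1) =
      departure (fun i => w (i + 1)) (fun i => l (i + 1)) (max s (w 0) + l 0) t := by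
  induction t with
  | zero => simp [departure]
  | succ t ih => rw [departure, ih, departure]

/-- If the server never idles, departures are partial sums of the service times. -/
theorem departure_eq_add_sum {w l : ℕ → ℝ} {s : ℝ} {t : ℕ}
    (h : ∀ u < t, w u ≤ departure w l s u) :
    departure w l s t = s + ∑ u ∈ Finset.range t, l u := by
  induction t with
  | zero => simp [departure]
  | succ t ih =>
    rw [departure, max_eq_left (h t (Nat.lt_succ_self t)),
      ih fun u hu => h u (hu.trans (Nat.lt_succ_self t)), Finset.sum_range_succ, add_assoc]

theorem lt_departure_of_departure_lt {w l : ℕ → ℝ} {a b : ℝ} {t : ℕ}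
    (h : departure w l a t < b + ∑ u ∈ Finset.range t, l u) {u : ℕ} (hu : u < t) :
    w u < departure w l b u := by
  induction t with
  | zero => omega
  | succ t ih =>
    rw [departure, Finset.sum_range_succ, ← add_assoc, add_lt_add_iff_right, max_lt_iff] at h
    rcases Nat.lt_succ_iff_lt_or_eq.mp hu with hu | rfl
    · exact ih h.1 hu
    · exact h.2.trans_le (add_sum_le_departure w l b u)

/-- A busy period started at `b` ends a service at time `0`, the server being free from `a`
on, iff the corresponding partial sum vanishes and the services without this period are over
before `0`. -/
theorem busy_hit_iff {w l : ℕ → ℝ} {a b : ℝ} {t : ℕ} (h0 : departure w l a t ≠ 0) :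
    (departure w l b t = 0 ∧ a ≤ b ∧ ∀ u < t, w u < departure w l b u) ↔
      (b + ∑ u ∈ Finset.range t, l u = 0 ∧ departure w l a t < 0) := by
  constructor
  · rintro ⟨h1, h2, h3⟩
    have h4 := departure_eq_add_sum fun u hu => (h3 u hu).le
    refine ⟨by rw [← h4, h1], lt_of_le_of_ne ?_ h0⟩
    have h5 := departure_max w l a b t
    rw [max_eq_right h2, h1] at h5
    rw [h5]
    exact le_max_left _ _
  · rintro ⟨h1, h2⟩
    rw [← h1] at h2
    have h3 : ∀ u < t, w u < departure w l b u := fun u hu => lt_departure_of_departure_lt h2 hu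
    refine ⟨by rw [departure_eq_add_sum fun u hu => (h3 u hu).le, h1], ?_, h3⟩
    have := add_sum_le_departure w l a t
    linarith

/-- Departure times of the customers from `j` on, when an additional customer of service time
`L` is served immediately before customer `j` in a queue that is free at time `s`. -/
noncomputable def delayedDeparture (w l : ℕ → ℝ) (L s : ℝ) (j : ℕ) : ℕ → ℝ :=
  departure (fun i => w (j + i)) (fun i => l (j + i)) (departure w l s j + L)

/-- Number of services ending before `0`, among the additional customer and the customers
`j, …, n - 1`, when the former is served immediately before customer `j`. -/
noncomputable def earlyCount (w l : ℕ → ℝ) (L s : ℝ) (n j : ℕ) : ℕ :=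
  {t ∈ Finset.range (n - j + 1) | delayedDeparture w l L s j t < 0}.card

/-- Numbers `t` of customers served after the additional one, inserted before customer `j`, in a
busy period that it starts and in which a service ends at time `0`. -/
noncomputable def hitIndices (w l : ℕ → ℝ) (L s : ℝ) (n j : ℕ) : Finset ℕ :=
  {t ∈ Finset.range (n - j + 1) | delayedDeparture w l L s j t < 0 ∧
    (j < n → -(L + ∑ u ∈ Finset.range t, l (j + u)) < w j)}

theorem earlyCount_eq {w l : ℕ → ℝ} {L s : ℝ} {n j : ℕ} (hj : j < n) (hL : 0 < L)
    (hg : ∀ t ≤ n - j, w j + (L + ∑ u ∈ Finset.range t, l (j + u)) ≠ 0) :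
    earlyCount w l L s n j = (hitIndices w l L s n j).card +
      (if max (departure w l s j) (w j) + L < 0 then 1 else 0) +
        earlyCount w l L s n (j + 1) := by
  have hmax : ∀ t, departure (fun i => w (j + i)) (fun i => l (j + i))
      (max (departure w l s j) (w j) + L) t =
      max (delayedDeparture w l L s j t) (w j + (L + ∑ u ∈ Finset.range t, l (j + u))) := by
    intro t
    rw [← max_add_add_right, departure_max, delayedDeparture, add_assoc]
  have hsucc : ∀ t, departure (fun i => w (j + i)) (fun i => l (j + i))
      (max (departure w l s j) (w j) + L) (t + 1) = delayedDeparture w l L s (j + 1) t := by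
    intro t
    rw [departure_succ_eq_shift, delayedDeparture, departure]
    congr 1
    · ext i; congr 1; ring
    · ext i; congr 1; ring
    · rw [add_zero, max_eq_left]
      · ring
      · have := le_max_right (departure w l s j) (w j)
        linarith
  have hrest : {t ∈ Finset.range (n - j + 1) | departure (fun i => w (j + i))
      (fun i => l (j + i)) (max (departure w l s j) (w j) + L) t < 0}.card =
      (if max (departure w l s j) (w j) + L < 0 then 1 else 0) +
        earlyCount w l L s n (j + 1) := by
    rw [Finset.card_filter, Finset.sum_range_succ', earlyCount, Finset.card_filter, add_comm]
    simp only [hsucc]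
    rw [show n - j = n - (j + 1) + 1 by omega]
    rfl
  rw [earlyCount, add_assoc, ← hrest, hitIndices, ← Finset.card_union_of_disjoint]
  · congr 1
    ext t
    simp only [Finset.mem_filter, Finset.mem_union, Finset.mem_range, hmax, max_lt_iff]
    constructor
    · rintro ⟨h1, h2⟩
      rcases lt_or_gt_of_ne (hg t (by omega)) with h | h
      · exact Or.inr ⟨h1, h2, h⟩
      · exact Or.inl ⟨h1, h2, fun _ => by linarith⟩
    · tauto
  · rw [Finset.disjoint_left]
    intro t ht ht'
    simp only [Finset.mem_filter, hmax, max_lt_iff] at ht ht'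
    have := ht.2.2 hj
    linarith [ht'.2.2]

theorem sum_card_hitIndices {w l : ℕ → ℝ} {L s : ℝ} {n : ℕ} (hL : 0 < L)
    (hg : ∀ j < n, ∀ t ≤ n - j, w j + (L + ∑ u ∈ Finset.range t, l (j + u)) ≠ 0) :
    ∑ j ∈ Finset.range (n + 1), (hitIndices w l L s n j).card +
      {j ∈ Finset.range n | max (departure w l s j) (w j) + L < 0}.card =
        earlyCount w l L s n 0 := by
  have key : ∀ m ≤ n, ∑ j ∈ Finset.range m, (hitIndices w l L s n j).card +
      {j ∈ Finset.range m | max (departure w l s j) (w j) + L < 0}.card +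
        earlyCount w l L s n m = earlyCount w l L s n 0 := by
    intro m
    induction m with
    | zero => simp
    | succ m ih =>
      intro hm
      rw [← ih (by omega), earlyCount_eq (j := m) (by omega) hL (hg m (by omega)),
        Finset.sum_range_succ, Finset.card_filter, Finset.card_filter, Finset.sum_range_succ]
      ring
  rw [← key n le_rfl, Finset.sum_range_succ]
  have : (hitIndices w l L s n n).card = earlyCount w l L s n n := by
    simp [hitIndices, earlyCount]
  omega

theorem ncard_hit_locations {w l : ℕ → ℝ} {L s : ℝ} {n : ℕ}
    (hl : ∀ i < n, 0 < l i) (hw : ∀ i j, i < j → j < n → w i < w j) :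
    {X : ℝ | ∃ j ≤ n, (∀ i < j, w i < X) ∧ (∀ i, j ≤ i → i < n → X < w i) ∧
      ∃ t ≤ n - j, X + L + ∑ u ∈ Finset.range t, l (j + u) = 0 ∧
        delayedDeparture w l L s j t < 0}.ncard =
      ∑ j ∈ Finset.range (n + 1), (hitIndices w l L s n j).card := by
  have hlt : ∀ j ≤ n, ∀ t, delayedDeparture w l L s j t < 0 → ∀ i < j,
      w i < -(L + ∑ u ∈ Finset.range t, l (j + u)) := by
    intro j hj t ht i hi
    obtain ⟨j, rfl⟩ : ∃ m, j = m + 1 := ⟨j - 1, by omega⟩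
    have h1 := add_sum_le_departure (fun i => w (j + 1 + i)) (fun i => l (j + 1 + i))
      (departure w l s (j + 1) + L) t
    rw [delayedDeparture] at ht
    rw [departure] at h1 ht
    have h2 := hl j (by omega)
    have h3 : w i ≤ w j := by
      rcases Nat.lt_succ_iff_lt_or_eq.mp hi with h | rfl
      · exact (hw i j h (by omega)).le
      · exact le_rfl
    have h4 := le_max_right (departure w l s j) (w j)
    linarith
  rw [← Finset.card_sigma, ← Finset.card_image_of_injOn
    (f := fun p : (_ : ℕ) × ℕ => -(L + ∑ u ∈ Finset.range p.2, l (p.1 + u))),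
    ← Set.ncard_coe_finset]
  · congr 1
    ext X
    simp only [Set.mem_ofPred_eq, Finset.coe_image, Set.mem_image, Finset.mem_coe,
      Finset.mem_sigma, Finset.mem_range, hitIndices, Finset.mem_filter, Sigma.exists]
    constructor
    · rintro ⟨j, hj, h1, h2, t, ht, h3, h4⟩
      have hX : -(L + ∑ u ∈ Finset.range t, l (j + u)) = X := by linarith
      exact ⟨j, t, ⟨by omega, by omega, h4, fun h => hX ▸ h2 j le_rfl h⟩, hX⟩
    · rintro ⟨j, t, ⟨hj, ht, h4, h5⟩, rfl⟩
      refine ⟨j, by omega, hlt j (by omega) t h4, ?_, t, by omega, by ring, h4⟩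
      intro i hji hi
      rcases hji.eq_or_lt with rfl | h
      · exact h5 hi
      · exact (h5 (h.trans hi)).trans (hw j i h hi)
  · have hdisj : ∀ j t j' t', j < j' → j' ≤ n → t ∈ hitIndices w l L s n j →
        t' ∈ hitIndices w l L s n j' → -(L + ∑ u ∈ Finset.range t, l (j + u)) <
          -(L + ∑ u ∈ Finset.range t', l (j' + u)) := by
      intro j t j' t' hjj hj' ht ht'
      simp only [hitIndices, Finset.mem_filter] at ht ht'
      exact (ht.2.2 (by omega)).trans (hlt j' hj' t' ht'.2.1 j hjj)
    have hmono : ∀ j t t', t < t' → t' ≤ n - j →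
        ∑ u ∈ Finset.range t, l (j + u) < ∑ u ∈ Finset.range t', l (j + u) := by
      intro j t t' h h'
      refine Finset.sum_lt_sum_of_subset (i := t) (Finset.range_mono h.le) (by simpa) (by simp)
        (hl _ (by omega)) fun i hi _ => (hl _ ?_).le
      rw [Finset.mem_range] at hi
      omega
    rintro ⟨j, t⟩ h ⟨j', t'⟩ h' heq
    simp only [Finset.coe_sigma, Set.mem_sigma_iff, Finset.mem_coe, Finset.mem_range] at h h' heq
    rcases lt_trichotomy j j' with hj | rfl | hj
    · exact absurd heq (hdisj j t j' t' hj (by omega) h.2 h'.2).ne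
    · have ht := h.2
      have ht' := h'.2
      simp only [hitIndices, Finset.mem_filter, Finset.mem_range] at ht ht'
      rcases lt_trichotomy t t' with hlt | rfl | hlt
      · have := hmono j t t' hlt (by omega)
        linarith
      · rfl
      · have := hmono j t' t hlt (by omega)
        linarith
    · exact absurd heq (hdisj j' t' j t hj (by omega) h'.2 h.2).ne'

theorem natExt_apply {n : ℕ} (f : Fin n → ℝ) (i : Fin n) : natExt f i = f i := by
  simp [natExt]

theorem natExt_insertNth_of_lt {n : ℕ} (f : Fin n → ℝ) (a : ℝ) (j : Fin (n + 1)) {i : ℕ}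
    (h : i < j) : natExt (j.insertNth a f : Fin (n + 1) → ℝ) i = natExt f i := by
  have hi : i < n := by omega
  have h1 : j.succAbove ⟨i, hi⟩ = ⟨i, by omega⟩ :=
    Fin.succAbove_of_castSucc_lt _ _ (by simpa [Fin.lt_def] using h)
  have h2 := Fin.insertNth_apply_succAbove (α := fun _ => ℝ) j a f ⟨i, hi⟩
  rw [h1] at h2
  simpa [natExt, hi, show i < n + 1 by omega] using h2

theorem natExt_insertNth_self {n : ℕ} (f : Fin n → ℝ) (a : ℝ) (j : Fin (n + 1)) :
    natExt (j.insertNth a f : Fin (n + 1) → ℝ) j = a := by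
  rw [natExt_apply, Fin.insertNth_apply_same]

theorem natExt_insertNth_add {n : ℕ} (f : Fin n → ℝ) (a : ℝ) (j : Fin (n + 1)) (t : ℕ) :
    natExt (j.insertNth a f : Fin (n + 1) → ℝ) (j + (t + 1)) = natExt f (j + t) := by
  by_cases hi : (j : ℕ) + t < n
  · have h1 : j.succAbove ⟨j + t, hi⟩ = ⟨j + (t + 1), by omega⟩ :=
      Fin.succAbove_of_le_castSucc _ _ (by simp [Fin.le_def])
    have h2 := Fin.insertNth_apply_succAbove (α := fun _ => ℝ) j a f ⟨j + t, hi⟩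
    rw [h1] at h2
    simpa [natExt, hi, show (j : ℕ) + (t + 1) < n + 1 by omega] using h2
  · simp [natExt, hi, show ¬ (j : ℕ) + (t + 1) < n + 1 by omega]

theorem lindleyNat_congr {w w' l l' : ℕ → ℝ} {i : ℕ} (hw : ∀ k ≤ i, w k = w' k)
    (hl : ∀ k < i, l k = l' k) : lindleyNat w l i = lindleyNat w' l' i := by
  induction i with
  | zero => exact hw 0 le_rfl
  | succ i ih =>
    rw [lindleyNat, lindleyNat, ih (fun k hk => hw k (by omega)) (fun k hk => hl k (by omega)),
      hw _ le_rfl, hl i (by omega)]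

theorem departure_succ_eq_lindleyNat {w l : ℕ → ℝ} {s : ℝ} (hs : s ≤ w 0) (t : ℕ) :
    departure w l s (t + 1) = lindleyNat w l t + l t := by
  induction t with
  | zero => simp [departure, lindleyNat, hs]
  | succ t ih => rw [departure, ih, lindleyNat]

theorem max_departure_eq_lindleyNat {w l : ℕ → ℝ} {s : ℝ} (hs : s ≤ w 0) (t : ℕ) :
    max (departure w l s t) (w t) = lindleyNat w l t :=
  add_right_cancel (departure_succ_eq_lindleyNat hs t)

theorem lindleyNat_add_eq_departure (w l : ℕ → ℝ) (j t : ℕ) :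
    lindleyNat w l (j + t) + l (j + t) =
      departure (fun i => w (j + (i + 1))) (fun i => l (j + (i + 1)))
        (lindleyNat w l j + l j) t := by
  induction t with
  | zero => rfl
  | succ t ih => rw [departure, ← ih, ← add_assoc, lindleyNat]

theorem lindleyNat_add_le {w l : ℕ → ℝ} {i k : ℕ} (hik : i < k)
    (hl : ∀ m < k, 0 ≤ l m) : lindleyNat w l i + l i ≤ lindleyNat w l k := by
  induction k with
  | zero => omega
  | succ k ih =>
    refine le_trans ?_ (le_max_left _ _)
    rcases Nat.lt_succ_iff_lt_or_eq.mp hik with h | rfl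
    · linarith [ih h fun m hm => hl m (by omega), hl k (by omega)]
    · exact le_rfl

theorem strictMono_insertNth {n : ℕ} {x : Fin n → ℝ} {X : ℝ} {j : Fin (n + 1)}
    (hx : StrictMono x) (hlt : ∀ i, i.castSucc < j → x i < X)
    (hgt : ∀ i, j ≤ i.castSucc → X < x i) :
    StrictMono (j.insertNth X x : Fin (n + 1) → ℝ) := by
  intro a b hab
  induction a using Fin.succAboveCases j with
  | x =>
    induction b using Fin.succAboveCases j with
    | x => exact absurd hab (lt_irrefl _)
    | p b =>
      rw [Fin.insertNth_apply_same, Fin.insertNth_apply_succAbove]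
      exact hgt b ((Fin.lt_succAbove_iff_le_castSucc _ _).mp hab)
  | p a =>
    induction b using Fin.succAboveCases j with
    | x =>
      rw [Fin.insertNth_apply_same, Fin.insertNth_apply_succAbove]
      exact hlt a ((Fin.succAbove_lt_iff_castSucc_lt _ _).mp hab)
    | p b =>
      rw [Fin.insertNth_apply_succAbove, Fin.insertNth_apply_succAbove]
      exact hx ((Fin.strictMono_succAbove j).lt_iff_lt.mp hab)

theorem snoc_comp_cycle {n : ℕ} (x : Fin n → ℝ) (X : ℝ) (j : Fin (n + 1)) :
    (Fin.snoc x X : Fin (n + 1) → ℝ) ∘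
      ((finSuccEquiv' j).trans (finSuccEquiv' (Fin.last n)).symm) =
        (j.insertNth X x : Fin (n + 1) → ℝ) := by
  ext i
  induction i using Fin.succAboveCases j with
  | x => simp
  | p i => simp

theorem sort_snoc {n : ℕ} {x : Fin n → ℝ} {X : ℝ} {j : Fin (n + 1)}
    (h : StrictMono (j.insertNth X x : Fin (n + 1) → ℝ)) :
    Tuple.sort (Fin.snoc x X : Fin (n + 1) → ℝ) =
      (finSuccEquiv' j).trans (finSuccEquiv' (Fin.last n)).symm := by
  symm
  rw [Tuple.eq_sort_iff, snoc_comp_cycle]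
  refine ⟨h.monotone, fun a b hab heq => absurd heq ?_⟩
  have := h hab
  rw [← snoc_comp_cycle] at this
  exact this.ne

/-- Hits by an additional rod, in terms of the busy period that it starts. -/
theorem isXHit_snoc_iff {n : ℕ} {x μ : Fin n → ℝ} {X L : ℝ} {j : Fin (n + 1)}
    (h : StrictMono (j.insertNth X x : Fin (n + 1) → ℝ)) :
    IsXHit (Fin.snoc x X) (Fin.snoc μ L) (Fin.last n) ↔
      (∀ i, i + 1 = (j : ℕ) → lindleyNat (natExt x) (natExt μ) i + natExt μ i ≤ X) ∧
      ∃ t ≤ n - j,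
        departure (fun i => natExt x (j + i)) (fun i => natExt μ (j + i)) (X + L) t = 0 ∧
        ∀ u < t, natExt x (j + u) <
          departure (fun i => natExt x (j + i)) (fun i => natExt μ (j + i)) (X + L) u := by
  set w' := natExt (j.insertNth X x : Fin (n + 1) → ℝ) with hw'
  set l' := natExt (j.insertNth L μ : Fin (n + 1) → ℝ) with hl'
  have hroot : lindleyNat w' l' j = X ↔
      ∀ i, i + 1 = (j : ℕ) → lindleyNat (natExt x) (natExt μ) i + natExt μ i ≤ X := by
    have hwj : w' j = X := natExt_insertNth_self x X j
    rcases Nat.eq_zero_or_eq_succ_pred (j : ℕ) with h0 | h0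
    · rw [h0] at hwj ⊢
      simp [lindleyNat, hwj]
    · set i := (j : ℕ).pred with hi
      have e : lindleyNat w' l' i = lindleyNat (natExt x) (natExt μ) i :=
        lindleyNat_congr (fun k hk => natExt_insertNth_of_lt x X j (by omega))
          (fun k hk => natExt_insertNth_of_lt μ L j (by omega))
      have e' : l' i = natExt μ i := natExt_insertNth_of_lt μ L j (by omega)
      rw [h0, Nat.succ_eq_add_one] at hwj
      rw [h0, Nat.succ_eq_add_one, lindleyNat, hwj, e, e', max_eq_right_iff]
      constructor
      · intro h k hk
        obtain rfl : k = i := by omega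
        exact h
      · intro h
        exact h i rfl
  have hdep : ∀ t, lindleyNat w' l' j = X → lindleyNat w' l' (j + t) + l' (j + t) =
      departure (fun i => natExt x (j + i)) (fun i => natExt μ (j + i)) (X + L) t := by
    intro t hX
    rw [lindleyNat_add_eq_departure, hX]
    simp only [hw', hl', natExt_insertNth_add, natExt_insertNth_self]
  have hne : ∀ u, lindleyNat w' l' j = X → (lindleyNat w' l' (j + (u + 1)) ≠ w' (j + (u + 1)) ↔
      natExt x (j + u) <
        departure (fun i => natExt x (j + i)) (fun i => natExt μ (j + i)) (X + L) u) := by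
    intro u hX
    have e : w' (j + (u + 1)) = natExt x (j + u) := natExt_insertNth_add x X j u
    rw [← hdep u hX, ← add_assoc, lindleyNat, add_assoc, e, ne_eq, max_eq_right_iff, not_le]
  rw [IsXHit, sort_snoc h, snoc_comp_cycle, snoc_comp_cycle, ← hroot]
  have hres : ∀ k, resolve (j.insertNth X x : Fin (n + 1) → ℝ)
      (j.insertNth L μ : Fin (n + 1) → ℝ) k = lindleyNat w' l' k := fun _ => rfl
  have hpt : ∀ k : Fin (n + 1), (j.insertNth X x : Fin (n + 1) → ℝ) k = w' k :=
    fun k => (natExt_apply _ k).symm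
  have hlt : ∀ k : Fin (n + 1), (j.insertNth L μ : Fin (n + 1) → ℝ) k = l' k :=
    fun k => (natExt_apply _ k).symm
  simp only [hres, hpt, hlt]
  have hwj : w' j = X := natExt_insertNth_self x X j
  constructor
  · rintro ⟨k, r, hrk, h1, h2, h3, h4⟩
    obtain rfl : r = j := by
      rw [← Equiv.eq_symm_apply] at h4
      simpa using h4
    rw [hwj] at h2
    refine ⟨h2, k - r, by omega, ?_, fun u hu => ?_⟩
    · rw [← hdep _ h2, show (r : ℕ) + (k - r) = k by omega, h1]
    · exact (hne u h2).mp (h3 ⟨r + (u + 1), by omega⟩ (by simp [Fin.lt_def])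
        (by simp only [Fin.le_def]; omega))
  · rintro ⟨h2, t, ht, h1, h3⟩
    refine ⟨⟨j + t, by omega⟩, j, by simp [Fin.le_def], ?_, by rw [hwj, h2], ?_, by simp⟩
    · rw [← hdep _ h2] at h1
      exact h1
    · intro i hi hi'
      obtain ⟨u, hu⟩ : ∃ u, (i : ℕ) = j + (u + 1) := ⟨i - j - 1, by omega⟩
      rw [hu]
      simp only [Fin.le_def] at hi'
      exact (hne u h2).mpr (h3 u (by omega))

/-- Values of the form `x m + ∑ i, c i * lam i` with natural coefficients; left and right ends
of resolved rods are of this form. -/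
def shiftedEnds {n : ℕ} (x : Fin n → ℝ) (lam : Fin (n + 1) → ℝ) : Set ℝ :=
  {v | ∃ (m : Fin n) (c : Fin (n + 1) → ℕ), v = x m + ∑ i, c i * lam i}

section shiftedEnds

variable {n : ℕ} {x : Fin n → ℝ} {lam : Fin (n + 1) → ℝ}

theorem self_mem_shiftedEnds (m : Fin n) : x m ∈ shiftedEnds x lam :=
  ⟨m, 0, by simp⟩

theorem add_mem_shiftedEnds {v : ℝ} (hv : v ∈ shiftedEnds x lam) (i : Fin (n + 1)) :
    v + lam i ∈ shiftedEnds x lam := by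
  obtain ⟨m, c, rfl⟩ := hv
  refine ⟨m, c + Pi.single i 1, ?_⟩
  simp [add_mul, Finset.sum_add_distrib, Pi.single_apply, add_assoc]

theorem max_mem_shiftedEnds {v v' : ℝ} (hv : v ∈ shiftedEnds x lam)
    (hv' : v' ∈ shiftedEnds x lam) : max v v' ∈ shiftedEnds x lam := by
  rcases max_choice v v' with h | h <;> rwa [h]

theorem departure_mem_shiftedEnds {w l : ℕ → ℝ} {s : ℝ} {t : ℕ} (hs : s ∈ shiftedEnds x lam)
    (hw : ∀ i < t, w i ∈ shiftedEnds x lam) (hl : ∀ i < t, ∃ k, l i = lam k) :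
    departure w l s t ∈ shiftedEnds x lam := by
  induction t with
  | zero => exact hs
  | succ t ih =>
    obtain ⟨k, hk⟩ := hl t (Nat.lt_succ_self t)
    rw [departure, hk]
    exact add_mem_shiftedEnds (max_mem_shiftedEnds
      (ih (fun i hi => hw i (by omega)) fun i hi => hl i (by omega)) (hw t (by omega))) k

theorem lindleyNat_mem_shiftedEnds {w l : ℕ → ℝ} {t : ℕ}
    (hw : ∀ i ≤ t, w i ∈ shiftedEnds x lam) (hl : ∀ i < t, ∃ k, l i = lam k) :
    lindleyNat w l t ∈ shiftedEnds x lam := by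
  induction t with
  | zero => exact hw 0 le_rfl
  | succ t ih =>
    obtain ⟨k, hk⟩ := hl t (Nat.lt_succ_self t)
    rw [lindleyNat, hk]
    exact max_mem_shiftedEnds (add_mem_shiftedEnds
      (ih (fun i hi => hw i (by omega)) fun i hi => hl i (by omega)) k) (hw _ le_rfl)

theorem add_sum_mem_shiftedEnds {l : ℕ → ℝ} {s : ℝ} {t : ℕ} (hs : s ∈ shiftedEnds x lam)
    (hl : ∀ i < t, ∃ k, l i = lam k) :
    s + ∑ u ∈ Finset.range t, l u ∈ shiftedEnds x lam := by
  induction t with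
  | zero => simpa using hs
  | succ t ih =>
    obtain ⟨k, hk⟩ := hl t (Nat.lt_succ_self t)
    rw [Finset.sum_range_succ, ← add_assoc, hk]
    exact add_mem_shiftedEnds (ih fun i hi => hl i (by omega)) k

theorem delayedDeparture_ne_zero {w l : ℕ → ℝ} {L s : ℝ} {j t : ℕ} (hs : s ≤ w 0)
    (hL : ∃ k, L = lam k) (hsL : s + L < 0) (hsL' : s + L ≤ w 0)
    (hw : ∀ i < j + t, w i ∈ shiftedEnds x lam) (hl : ∀ i < j + t, ∃ k, l i = lam k)
    (hg : (0 : ℝ) ∉ shiftedEnds x lam) : delayedDeparture w l L s j t ≠ 0 := by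
  obtain ⟨k, rfl⟩ := hL
  have key : delayedDeparture w l (lam k) s j t < 0 ∨
      delayedDeparture w l (lam k) s j t ∈ shiftedEnds x lam := by
    rw [delayedDeparture]
    rcases j with _ | j
    · rcases t with _ | t
      · exact Or.inl hsL
      · right
        simp only [Nat.zero_add] at hw hl ⊢
        rw [departure, departure_succ_eq_lindleyNat hsL']
        obtain ⟨k', hk'⟩ := hl t (by omega)
        rw [hk']
        exact add_mem_shiftedEnds (lindleyNat_mem_shiftedEnds (fun i hi => hw i (by omega))
          fun i hi => hl i (by omega)) k'
    · right
      rw [departure_succ_eq_lindleyNat hs]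
      obtain ⟨k', hk'⟩ := hl j (by omega)
      rw [hk']
      exact departure_mem_shiftedEnds (add_mem_shiftedEnds (add_mem_shiftedEnds
        (lindleyNat_mem_shiftedEnds (fun i hi => hw i (by omega)) fun i hi => hl i (by omega))
        k') k) (fun i hi => hw _ (by omega)) fun i hi => hl _ (by omega)
  intro h0
  rcases key with h | h
  · exact h.ne h0
  · exact hg (h0 ▸ h)

end shiftedEnds

/-- Hit locations are given by the partial sums selected in `hitIndices`. -/
theorem setOf_isXHit_eq {n : ℕ} {x μ : Fin n → ℝ} {L s : ℝ} (hx : StrictMono x)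
    (hs : s ≤ natExt x 0) (hsL : s + L < 0) (hsL' : s + L ≤ natExt x 0)
    (hg : ∀ j ≤ n, ∀ t ≤ n - j, delayedDeparture (natExt x) (natExt μ) L s j t ≠ 0) :
    {X : ℝ | (∀ i, X ≠ x i) ∧ IsXHit (Fin.snoc x X) (Fin.snoc μ L) (Fin.last n)} =
    {X : ℝ | ∃ j ≤ n, (∀ i < j, natExt x i < X) ∧ (∀ i, j ≤ i → i < n → X < natExt x i) ∧
      ∃ t ≤ n - j, X + L + ∑ u ∈ Finset.range t, natExt μ (j + u) = 0 ∧
        delayedDeparture (natExt x) (natExt μ) L s j t < 0} := by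
  have hnat : ∀ i (hi : i < n), natExt x i = x ⟨i, hi⟩ := fun i hi => natExt_apply x ⟨i, hi⟩
  have key : ∀ (X : ℝ) (j : ℕ), j ≤ n → (∀ i < j, natExt x i < X) →
      (∀ i, j ≤ i → i < n → X < natExt x i) →
      (IsXHit (Fin.snoc x X) (Fin.snoc μ L) (Fin.last n) ↔
        ∃ t ≤ n - j, X + L + ∑ u ∈ Finset.range t, natExt μ (j + u) = 0 ∧
          delayedDeparture (natExt x) (natExt μ) L s j t < 0) := by
    intro X j hj h1 h2
    have hmono : StrictMono ((⟨j, by omega⟩ : Fin (n + 1)).insertNth X x : Fin (n + 1) → ℝ) := by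
      refine strictMono_insertNth hx (fun i hi => ?_) fun i hi => ?_
      · rw [← natExt_apply x i]
        exact h1 i (by simpa [Fin.lt_def] using hi)
      · rw [← natExt_apply x i]
        exact h2 i (by simpa [Fin.le_def] using hi) i.2
    rw [isXHit_snoc_iff hmono, ← exists_and_left]
    refine exists_congr fun t => ?_
    rw [and_left_comm, and_congr_right_iff]
    intro ht
    rw [delayedDeparture, ← busy_hit_iff (hg j hj t ht), and_left_comm, and_congr_right_iff]
    intro h3
    rw [and_congr_left_iff]
    intro h4
    rw [add_le_add_iff_right]
    rcases j with _ | j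
    · refine iff_of_true (fun i hi => by simp at hi) ?_
      rw [departure]
      rcases t with _ | t
      · rw [departure] at h3
        linarith
      · have := h4 0 (by omega)
        simp only [departure, Nat.add_zero] at this
        linarith
    · rw [departure_succ_eq_lindleyNat hs]
      constructor
      · intro h
        exact h j rfl
      · intro h i hi
        obtain rfl : i = j := by simpa using hi
        exact h
  ext X
  simp only [Set.mem_ofPred_eq]
  constructor
  · rintro ⟨hne, hhit⟩
    have hex : ∃ j, n ≤ j ∨ X < natExt x j := ⟨n, Or.inl le_rfl⟩
    classical
    have hj : Nat.find hex ≤ n := Nat.find_min' hex (Or.inl le_rfl)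
    have hlt : ∀ i < Nat.find hex, natExt x i < X := by
      intro i hi
      have h := Nat.find_min hex hi
      push Not at h
      refine lt_of_le_of_ne h.2 ?_
      rw [hnat i h.1]
      exact (hne _).symm
    have hgt : ∀ i, Nat.find hex ≤ i → i < n → X < natExt x i := by
      intro i hi hin
      rcases Nat.find_spec hex with h | h
      · omega
      · refine h.trans_le ?_
        rw [hnat _ (by omega), hnat _ hin]
        exact hx.monotone (by simpa [Fin.le_def] using hi)
    exact ⟨_, hj, hlt, hgt, (key X _ hj hlt hgt).mp hhit⟩
  · rintro ⟨j, hj, hlt, hgt, h⟩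
    refine ⟨fun i hi => ?_, (key X j hj hlt hgt).mpr h⟩
    rw [← natExt_apply x i] at hi
    rcases lt_or_ge (i : ℕ) j with hij | hij
    · exact (hlt i hij).ne' hi
    · exact (hgt i hij i.2).ne hi

theorem earlyCount_zero {w l : ℕ → ℝ} {L s : ℝ} {n : ℕ} (hsL : s + L < 0)
    (hsL' : s + L ≤ w 0) :
    earlyCount w l L s n 0 =
      {j ∈ Finset.range n | lindleyNat w l j + l j < 0}.card + 1 := by
  rw [earlyCount, Finset.card_filter, Finset.card_filter, Finset.sum_range_succ']
  congr 1
  · refine Finset.sum_congr rfl fun t _ => ?_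
    simp only [delayedDeparture, Nat.zero_add]
    rw [departure, departure_succ_eq_lindleyNat hsL']
  · simp [delayedDeparture, departure, hsL]

/-- Number of hit locations, for data in general position. -/
theorem ncard_isXHit_add {n : ℕ} {x μ : Fin n → ℝ} {lam : Fin (n + 1) → ℝ} {L : ℝ}
    (hx : StrictMono x) (hμ : ∀ i, 0 < μ i) (hL : 0 < L) (hμl : ∀ i, ∃ k, μ i = lam k)
    (hLl : ∃ k, L = lam k) (hg : (0 : ℝ) ∉ shiftedEnds x lam) :
    {X : ℝ | (∀ i, X ≠ x i) ∧
        IsXHit (Fin.snoc x X) (Fin.snoc μ L) (Fin.last n)}.ncard +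
      ∑ i, (if resolve x μ i + L < 0 then 1 else 0) =
        ∑ i, (if resolve x μ i + μ i < 0 then 1 else 0) + 1 := by
  have hnat : ∀ i (hi : i < n), natExt x i = x ⟨i, hi⟩ := fun i hi => natExt_apply x ⟨i, hi⟩
  have hnatl : ∀ i (hi : i < n), natExt μ i = μ ⟨i, hi⟩ := fun i hi => natExt_apply μ ⟨i, hi⟩
  have hw : ∀ i < n, natExt x i ∈ shiftedEnds x lam := fun i hi => by
    rw [hnat i hi]; exact self_mem_shiftedEnds _
  have hl : ∀ i < n, ∃ k, natExt μ i = lam k := fun i hi => by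
    rw [hnatl i hi]; exact hμl _
  obtain ⟨s, hs, hsL, hsL'⟩ : ∃ s, s ≤ natExt x 0 ∧ s + L < 0 ∧ s + L ≤ natExt x 0 := by
    refine ⟨min 0 (natExt x 0) - L - 1, ?_, ?_, ?_⟩ <;>
      linarith [min_le_left 0 (natExt x 0), min_le_right 0 (natExt x 0)]
  rw [setOf_isXHit_eq hx hs hsL hsL', ncard_hit_locations]
  · have h1 := sum_card_hitIndices (w := natExt x) (l := natExt μ) (s := s) (n := n) hL
      fun j hj t ht h0 => by
        obtain ⟨k, rfl⟩ := hLl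
        rw [← add_assoc] at h0
        refine hg (h0 ▸ add_sum_mem_shiftedEnds (l := fun u => natExt μ (j + u))
          (add_mem_shiftedEnds (hw j hj) k) fun i hi => hl _ (by omega))
    rw [earlyCount_zero hsL hsL'] at h1
    simp only [max_departure_eq_lindleyNat hs] at h1
    rw [Finset.card_filter, Finset.card_filter, Finset.sum_range (n := n),
      Finset.sum_range (n := n)] at h1
    simp only [natExt_apply] at h1
    exact h1
  · intro i hi
    rw [hnatl i hi]
    exact hμ _
  · intro i j hij hj
    rw [hnat i (by omega), hnat j hj]
    exact hx hij
  · intro j hj t ht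
    exact delayedDeparture_ne_zero hs hLl hsL hsL' (fun i hi => hw i (by omega))
      (fun i hi => hl i (by omega)) hg

theorem resolve_mem_shiftedEnds {n : ℕ} {x μ : Fin n → ℝ} {lam : Fin (n + 1) → ℝ}
    (hμl : ∀ i, ∃ k, μ i = lam k) (i : Fin n) : resolve x μ i ∈ shiftedEnds x lam := by
  refine lindleyNat_mem_shiftedEnds (fun k hk => ?_) fun k hk => ?_
  · rw [← Fin.val_mk (show k < n by omega), natExt_apply]
    exact self_mem_shiftedEnds _
  · rw [← Fin.val_mk (show k < n by omega), natExt_apply]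
    exact hμl _

theorem resolve_add_le {n : ℕ} {x μ : Fin n → ℝ} (hμ : ∀ i, 0 < μ i) {i k : Fin n}
    (hik : i < k) : resolve x μ i + μ i ≤ resolve x μ k := by
  have := lindleyNat_add_le (w := natExt x) (l := natExt μ) hik fun m hm => by
    rw [← Fin.val_mk (show m < n by omega), natExt_apply]
    exact (hμ _).le
  rwa [natExt_apply] at this

theorem ncard_isXHit_add_body {n : ℕ} {x μ : Fin n → ℝ} {lam : Fin (n + 1) → ℝ} {L : ℝ}
    (hx : StrictMono x) (hμ : ∀ i, 0 < μ i) (hL : 0 < L) (hμl : ∀ i, ∃ k, μ i = lam k)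
    (hLl : ∃ k, L = lam k) (hg : (0 : ℝ) ∉ shiftedEnds x lam) :
    {X : ℝ | (∀ i, X ≠ x i) ∧
        IsXHit (Fin.snoc x X) (Fin.snoc μ L) (Fin.last n)}.ncard +
      ∑ i, (if resolve x μ i ≤ -L ∧ -L ≤ resolve x μ i + μ i then 1 else 0) =
        {i : Fin n | -L ≤ resolve x μ i + μ i ∧ resolve x μ i + μ i ≤ 0}.ncard + 1 := by
  have h1 := ncard_isXHit_add hx hμ hL hμl hLl hg
  have h2 : ∑ i, (if resolve x μ i + μ i < 0 then 1 else 0) +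
      ∑ i, (if resolve x μ i ≤ -L ∧ -L ≤ resolve x μ i + μ i then 1 else 0) =
      {i : Fin n | -L ≤ resolve x μ i + μ i ∧ resolve x μ i + μ i ≤ 0}.ncard +
      ∑ i, (if resolve x μ i + L < 0 then 1 else 0) := by
    classical
    rw [Set.ncard_eq_toFinset_card', Set.toFinset_ofPred, Finset.card_filter,
      ← Finset.sum_add_distrib, ← Finset.sum_add_distrib]
    refine Finset.sum_congr rfl fun i _ => ?_
    obtain ⟨k, hk⟩ := hμl i
    obtain ⟨k', hk'⟩ := hLl
    have hz := resolve_mem_shiftedEnds (x := x) hμl i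
    have hy := add_mem_shiftedEnds hz k
    have hzL := add_mem_shiftedEnds hz k'
    have hyL := add_mem_shiftedEnds hy k'
    rw [← hk] at hy hyL
    rw [← hk'] at hzL hyL
    have ny := ne_of_mem_of_not_mem hy hg
    have nzL := ne_of_mem_of_not_mem hzL hg
    have nyL := ne_of_mem_of_not_mem hyL hg
    have := hμ i
    generalize resolve x μ i = z at *
    rcases lt_or_gt_of_ne ny with a | a <;> rcases lt_or_gt_of_ne nzL with b | b <;>
      rcases lt_or_gt_of_ne nyL with c | c <;> split_ifs <;> first | rfl | (exfalso; grind)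
  omega

theorem sum_body_eq_one {n : ℕ} {x μ : Fin n → ℝ} {lam : Fin (n + 1) → ℝ} {L : ℝ}
    (hμ : ∀ i, 0 < μ i) (hμl : ∀ i, ∃ k, μ i = lam k)
    (hLl : ∃ k, L = lam k) (hg : (0 : ℝ) ∉ shiftedEnds x lam)
    (hex : ∃ i, resolve x μ i ≤ -L ∧ -L ≤ resolve x μ i + μ i) :
    ∑ i, (if resolve x μ i ≤ -L ∧ -L ≤ resolve x μ i + μ i then 1 else 0) = 1 := by
  have hnot : ∀ i k, i < k → -L ≤ resolve x μ i + μ i → resolve x μ k ≤ -L → False := by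
    intro i k hik h1 h2
    obtain ⟨m, rfl⟩ := hLl
    have h3 := resolve_add_le (x := x) hμ hik
    have h4 := add_mem_shiftedEnds (resolve_mem_shiftedEnds (x := x) hμl k) m
    exact hg ((show resolve x μ k + lam m = 0 by linarith) ▸ h4)
  obtain ⟨k, hk⟩ := hex
  rw [Finset.sum_eq_single k, if_pos hk]
  · intro i _ hik
    rw [if_neg]
    rintro ⟨h1, h2⟩
    rcases lt_or_gt_of_ne hik with h | h
    · exact hnot i k h h2 hk.1
    · exact hnot k i h hk.2 h1
  · simp

theorem ae_zero_notMem_shiftedEnds (n : ℕ) :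
    ∀ᵐ xl : (Fin n → ℝ) × (Fin (n + 1) → ℝ) ∂volume, (0 : ℝ) ∉ shiftedEnds xl.1 xl.2 := by
  have key : ∀ (m : Fin n) (c : Fin (n + 1) → ℕ),
      ∀ᵐ xl : (Fin n → ℝ) × (Fin (n + 1) → ℝ) ∂volume,
        xl.1 m + ∑ i, c i * xl.2 i ≠ 0 := by
    intro m c
    let φ : (Fin n → ℝ) × (Fin (n + 1) → ℝ) →ₗ[ℝ] ℝ :=
      (LinearMap.proj m).comp (LinearMap.fst ℝ _ _) +
        (∑ i, (c i : ℝ) • LinearMap.proj i).comp (LinearMap.snd ℝ _ _)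
    have hφ : ∀ xl, φ xl = xl.1 m + ∑ i, c i * xl.2 i := by
      intro xl
      simp [φ]
    have hker : LinearMap.ker φ ≠ ⊤ := by
      intro h
      have h1 : ((Pi.single m 1, 0) : (Fin n → ℝ) × (Fin (n + 1) → ℝ)) ∈ LinearMap.ker φ :=
        h ▸ Submodule.mem_top
      rw [LinearMap.mem_ker, hφ] at h1
      simp at h1
    have : (volume : Measure ((Fin n → ℝ) × (Fin (n + 1) → ℝ))).IsAddHaarMeasure :=
      Measure.prod.instIsAddHaarMeasure _ _
    have h0 := Measure.addHaar_submodule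
      (volume : Measure ((Fin n → ℝ) × (Fin (n + 1) → ℝ))) _ hker
    rw [ae_iff]
    convert h0 using 2
    ext xl
    simp [hφ]
  filter_upwards [ae_all_iff.mpr fun m => ae_all_iff.mpr (key m)] with xl h
  rintro ⟨m, c, h0⟩
  exact h m c h0.symm

/-- **Lemma (hit-count formula).** For Lebesgue-almost every choice of left ends
`x₁ < … < xₙ` and positive lengths `λ₁ < … < λ_{n+1}`, and every permutation `π`:
letting `R_π` be the r-configuration obtained by resolving the conflicts of the rods
`λ_{π i}` placed at `x i` (`i < n`), `S_π` the number of its right ends lying in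
`[−λ_{π (last)}, 0]`, and `N_π` the number of locations `X` producing an `X`-hit of the
origin, one has `N_π = S_π` if the point `−λ_{π (last)}` belongs to the body of some
cluster of `R_π` (equivalently, to some resolved rod `[z k, z k + l k]`), and
`N_π = S_π + 1` otherwise. -/
theorem hit_count_formula (n : ℕ) :
    ∀ᵐ xl : (Fin n → ℝ) × (Fin (n + 1) → ℝ) ∂volume,
      (StrictMono xl.1 ∧ StrictMono xl.2 ∧ ∀ i, 0 < xl.2 i) →
        ∀ π : Equiv.Perm (Fin (n + 1)),
          ((∃ k : Fin n,
              resolve xl.1 (fun i => xl.2 (π i.castSucc)) k ≤ -(xl.2 (π (Fin.last n))) ∧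
              -(xl.2 (π (Fin.last n))) ≤ resolve xl.1 (fun i => xl.2 (π i.castSucc)) k
                  + xl.2 (π k.castSucc)) →
            Set.ncard {X : ℝ | (∀ i, X ≠ xl.1 i) ∧
                IsXHit (Fin.snoc xl.1 X) (xl.2 ∘ π) (Fin.last n)} =
              Set.ncard {i : Fin n |
                -(xl.2 (π (Fin.last n))) ≤ resolve xl.1 (fun j => xl.2 (π j.castSucc)) i
                    + xl.2 (π i.castSucc) ∧
                resolve xl.1 (fun j => xl.2 (π j.castSucc)) i + xl.2 (π i.castSucc) ≤ 0}) ∧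
          ((¬ ∃ k : Fin n,
              resolve xl.1 (fun i => xl.2 (π i.castSucc)) k ≤ -(xl.2 (π (Fin.last n))) ∧
              -(xl.2 (π (Fin.last n))) ≤ resolve xl.1 (fun i => xl.2 (π i.castSucc)) k
                  + xl.2 (π k.castSucc)) →
            Set.ncard {X : ℝ | (∀ i, X ≠ xl.1 i) ∧
                IsXHit (Fin.snoc xl.1 X) (xl.2 ∘ π) (Fin.last n)} =
              Set.ncard {i : Fin n |
                -(xl.2 (π (Fin.last n))) ≤ resolve xl.1 (fun j => xl.2 (π j.castSucc)) i
                    + xl.2 (π i.castSucc) ∧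
                resolve xl.1 (fun j => xl.2 (π j.castSucc)) i + xl.2 (π i.castSucc) ≤ 0}
                + 1) := by
  filter_upwards [ae_zero_notMem_shiftedEnds n] with ⟨x, lam⟩ hg
  rintro ⟨hx, -, hpos⟩ π
  have hsnoc : lam ∘ π = Fin.snoc (fun i : Fin n => lam (π i.castSucc)) (lam (π (Fin.last n))) :=
    (Fin.snoc_init_self (lam ∘ π)).symm
  have hmain := ncard_isXHit_add_body hx (μ := fun i => lam (π i.castSucc))
    (fun i => hpos _) (hpos (π (Fin.last n))) (fun i => ⟨_, rfl⟩) ⟨_, rfl⟩ hg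
  simp only [hsnoc]
  constructor
  · intro hex
    rw [sum_body_eq_one (μ := fun i => lam (π i.castSucc)) (fun i => hpos _)
      (fun i => ⟨_, rfl⟩) ⟨_, rfl⟩ hg hex] at hmain
    exact Nat.add_right_cancel hmain
  · intro hex
    rw [Finset.sum_eq_zero fun i _ => if_neg fun hi => hex ⟨i, hi⟩] at hmain
    exact hmain
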